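/- arXiv:math/9810191 — 2 statements merged into one kernel-verified Lean document; each statement's English description precedes it below -/
import Mathlib

section
/- The group B₄/Z(B₄) admits the presentation ⟨x, y | x⁴ = y³ = 1, [x², yxy] = 1⟩, where under the quotient map x corresponds to σ₁σ₂σ₃ and y to σ₁σ₂σ₃σ₁. -/
/-- The Artin relations for the braid group `B₄` on generators `σ₁ σ₂ σ₃`
(indexed by `0 1 2`). -/
def braidRels4 : Set (FreeGroup (Fin 3)) :=
  { FreeGroup.of 0 * FreeGroup.of 1 * FreeGroup.of 0 *
      (FreeGroup.of 1 * FreeGroup.of 0 * FreeGroup.of 1)⁻¹,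
    FreeGroup.of 1 * FreeGroup.of 2 * FreeGroup.of 1 *
      (FreeGroup.of 2 * FreeGroup.of 1 * FreeGroup.of 2)⁻¹,
    FreeGroup.of 0 * FreeGroup.of 2 * (FreeGroup.of 2 * FreeGroup.of 0)⁻¹ }

/-- The braid group on four strands. -/
abbrev BraidGroup4 : Type := PresentedGroup braidRels4

/-- The Artin generators of `B₄`. -/
def σB (i : Fin 3) : BraidGroup4 := PresentedGroup.of i

/-- Relations `x⁴ = y³ = 1`, `[x², yxy] = 1` (with `[a,b] = a⁻¹b⁻¹ab`). -/
def quadRels : Set (FreeGroup (Fin 2)) :=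
  { (FreeGroup.of 0) ^ 4, (FreeGroup.of 1) ^ 3,
    ((FreeGroup.of 0) ^ 2)⁻¹ * (FreeGroup.of 1 * FreeGroup.of 0 * FreeGroup.of 1)⁻¹ *
      (FreeGroup.of 0) ^ 2 * (FreeGroup.of 1 * FreeGroup.of 0 * FreeGroup.of 1) }

namespace Monoid.CoprodI

/-- A free product of at least two nontrivial groups has trivial center. -/
theorem center_eq_bot {ι : Type*} [Nontrivial ι] (G : ι → Type*) [∀ i, Group (G i)]
    [∀ i, Nontrivial (G i)] : Subgroup.center (CoprodI G) = ⊥ := by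
  classical
  have prod_injective : Function.Injective (Word.prod (M := G)) := Word.equiv.symm.injective
  rw [eq_bot_iff]
  intro c hc
  rw [Subgroup.mem_center_iff] at hc
  obtain ⟨w, rfl⟩ := Word.equiv.symm.surjective c
  change ∀ g, g * w.prod = w.prod * g at hc
  change w.prod ∈ _
  obtain ⟨l, hl, hch⟩ := w
  rcases l with _ | ⟨⟨i, a⟩, t⟩
  · exact Subgroup.mem_bot.2 Word.prod_empty
  exfalso
  rcases h_last : ((⟨i, a⟩ :: t : List (Σ i, G i))).getLast? with _ | ⟨j, b⟩
  · simp at h_last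
  by_cases hij : j = i
  · subst hij
    obtain ⟨k, hk⟩ := exists_ne j
    obtain ⟨h, h_ne⟩ := exists_ne (1 : G k)
    let w₁ : Word G := ⟨⟨k, h⟩ :: ⟨j, a⟩ :: t, by simpa [h_ne] using hl,
      List.isChain_cons.2 ⟨by simpa using hk, hch⟩⟩
    let w₂ : Word G := ⟨(⟨j, a⟩ :: t) ++ [⟨k, h⟩], by
      intro l hmem
      rcases List.mem_append.1 hmem with hmem | hmem
      · exact hl l hmem
      · rw [List.mem_singleton.1 hmem]; exact h_ne,
      List.isChain_append.2 ⟨hch, by simp, by rw [h_last]; simpa using hk.symm⟩⟩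
    have h_eq : w₁ = w₂ := prod_injective <| by
      simpa [w₁, w₂, Word.prod, mul_assoc] using hc (of h)
    have := congrArg Word.toList h_eq
    simp only [w₁, w₂, List.cons_append, List.cons.injEq, Sigma.mk.injEq] at this
    exact hk this.1.1
  · have ht : t.getLast? = some ⟨j, b⟩ := by
      cases t with
      | nil => simp at h_last; exact absurd h_last.1.symm hij
      | cons => simpa using h_last
    let w₁ : Word G := ⟨⟨i, a⟩ :: t, hl, hch⟩
    let w₂ : Word G := ⟨t ++ [⟨i, a⟩], fun l hmem => hl l (by
        rcases List.mem_append.1 hmem with hmem | hmem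
        · exact List.mem_cons_of_mem _ hmem
        · rw [List.mem_singleton.1 hmem]; exact List.mem_cons_self),
      List.isChain_append.2 ⟨(List.isChain_cons.1 hch).2, by simp, by rw [ht]; simpa using hij⟩⟩
    have h_eq : w₁ = w₂ := prod_injective <| by
      have := hc (of a)
      simp only [Word.prod, List.map_cons, List.prod_cons, mul_assoc, mul_right_inj] at this
      simpa [w₁, w₂, Word.prod, mul_assoc] using this
    have := congrArg (fun w : Word G => w.toList.getLast?) h_eq
    simp only [w₁, w₂, h_last, List.getLast?_append, List.getLast?_singleton, Option.some_or,
      Option.some.injEq, Sigma.mk.injEq] at this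
    exact hij this.1

end Monoid.CoprodI

/-- The free product of the cyclic groups `ℤ/nᵢ`. -/
abbrev CyclicFreeProduct {ι : Type*} (n : ι → ℕ) : Type _ :=
  Monoid.CoprodI fun i => Multiplicative (ZMod (n i))

namespace CyclicFreeProduct

variable {ι : Type*} {n : ι → ℕ} {G : Type*} [Group G]

/-- The standard generator of the `i`-th cyclic factor. -/
def gen (n : ι → ℕ) (i : ι) : CyclicFreeProduct n :=
  Monoid.CoprodI.of (i := i) (Multiplicative.ofAdd (1 : ZMod (n i)))

theorem gen_pow (i : ι) : gen n i ^ n i = 1 := by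
  rw [gen, ← map_pow, ← ofAdd_nsmul]
  simp

/-- The homomorphism sending the generators to given elements of suitable orders. -/
def lift (g : ι → G) (hg : ∀ i, g i ^ n i = 1) : CyclicFreeProduct n →* G :=
  Monoid.CoprodI.lift fun i => AddMonoidHom.toMultiplicativeLeft
    (ZMod.lift (n i) ⟨zmultiplesHom (Additive G) (Additive.ofMul (g i)), by
      simp [← ofMul_pow, hg]⟩)

@[simp]
theorem lift_gen (g : ι → G) (hg : ∀ i, g i ^ n i = 1) (i : ι) : lift g hg (gen n i) = g i := by
  rw [lift, gen, Monoid.CoprodI.lift_of]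
  have := ZMod.lift_coe (n i) ⟨zmultiplesHom (Additive G) (Additive.ofMul (g i)), by
      simp [← ofMul_pow, hg]⟩ 1
  simp only [Int.cast_one] at this
  simp [this]

theorem hom_ext {f g : CyclicFreeProduct n →* G} (h : ∀ i, f (gen n i) = g (gen n i)) :
    f = g := by
  refine Monoid.CoprodI.ext_hom f g fun i => MonoidHom.ext fun m => ?_
  obtain ⟨k, hk⟩ := ZMod.intCast_surjective (Multiplicative.toAdd m)
  have hm : m = Multiplicative.ofAdd (1 : ZMod (n i)) ^ k := by
    rw [← ofAdd_zsmul, zsmul_one, hk, ofAdd_toAdd]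
  rw [hm, map_zpow, map_zpow]
  exact congrArg (· ^ k) (h i)

theorem center_eq_bot [Nontrivial ι] (hn : ∀ i, n i ≠ 1) :
    Subgroup.center (CyclicFreeProduct n) = ⊥ := by
  have (i : ι) : Nontrivial (Multiplicative (ZMod (n i))) :=
    have := ZMod.nontrivial_iff.2 (hn i)
    inferInstance
  exact Monoid.CoprodI.center_eq_bot _

end CyclicFreeProduct

section BraidRelations

variable {G : Type*} [Group G] {a b c : G}

theorem braid_conj_first (hab : a * b * a = b * a * b) (hac : a * c = c * a) :
    a * b * c * a = b * (a * b * c) := by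
  calc a * b * c * a = a * b * (c * a) := by group
    _ = a * b * a * c := by rw [← hac]; group
    _ = b * (a * b * c) := by rw [hab]; group

theorem braid_conj_second (hbc : b * c * b = c * b * c) (hac : a * c = c * a) :
    a * b * c * b = c * (a * b * c) := by
  calc a * b * c * b = a * (b * c * b) := by group
    _ = (a * c) * b * c := by rw [hbc]; group
    _ = c * (a * b * c) := by rw [hac]; group

theorem braid_conj_sq_third (hab : a * b * a = b * a * b) (hbc : b * c * b = c * b * c)
    (hac : a * c = c * a) : (a * b * c) ^ 2 * c = a * (a * b * c) ^ 2 := by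
  have key : b * c * a * b * c = a * b * a * c * b := by
    calc b * c * a * b * c = b * (c * a) * b * c := by group
      _ = b * a * (c * b * c) := by rw [← hac]; group
      _ = b * a * b * c * b := by rw [← hbc]; group
      _ = a * b * a * c * b := by rw [← hab]
  calc (a * b * c) ^ 2 * c = a * (b * c * a * b * c) * c := by rw [pow_two]; group
    _ = a * a * b * (a * c) * b * c := by rw [key]; group
    _ = a * a * b * a * (b * c * b) := by rw [hbc]; group
    _ = a * a * (b * a * b) * c * b := by group
    _ = a * a * (a * b * a * c * b) := by rw [← hab]; group
    _ = a * (a * b * c) ^ 2 := by rw [← key, pow_two]; group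

theorem braid_first_pow_conj (hab : a * b * a = b * a * b) (hbc : b * c * b = c * b * c)
    (hac : a * c = c * a) : (a * b * c) ^ 4 * a = a * (a * b * c) ^ 4 := by
  have h₁ := braid_conj_first hab hac
  have h₂ := braid_conj_second hbc hac
  have h₃ := braid_conj_sq_third hab hbc hac
  generalize a * b * c = d at *
  calc d ^ 4 * a = d ^ 3 * (d * a) := by simp only [pow_succ, pow_zero, one_mul, mul_assoc]
    _ = d ^ 2 * (d * b) * d := by rw [h₁]; simp only [pow_succ, pow_zero, one_mul, mul_assoc]
    _ = d ^ 2 * c * d ^ 2 := by rw [h₂]; simp only [pow_succ, pow_zero, one_mul, mul_assoc]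
    _ = a * d ^ 4 := by rw [h₃]; simp only [pow_succ, pow_zero, one_mul, mul_assoc]

theorem braid_cube_eq (hab : a * b * a = b * a * b) (hbc : b * c * b = c * b * c)
    (hac : a * c = c * a) : (a * b * c * a) ^ 3 = (a * b * c) ^ 4 := by
  have h₁ := braid_conj_first hab hac
  have h₂ := braid_conj_second hbc hac
  have h₃ := braid_conj_sq_third hab hbc hac
  calc (a * b * c * a) ^ 3 = (a * b * c * a) * (a * b * c * a) * (a * b * c * a) := by
        rw [pow_succ, pow_two]
    _ = (a * b * c * a) * (b * (a * b * c)) * (b * (a * b * c)) := by rw [h₁]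
    _ = (a * b * c * a) * b * (a * b * c * b) * (a * b * c) := by simp only [mul_assoc]
    _ = (a * b * c) * (a * b * c) * (a * b * c) * (a * b * c) := by rw [h₂]; simp only [mul_assoc]
    _ = (a * b * c) ^ 4 := by simp only [pow_succ, pow_zero, one_mul, mul_assoc]

theorem braid_sq_commute (hab : a * b * a = b * a * b) (hbc : b * c * b = c * b * c)
    (hac : a * c = c * a) :
    Commute ((a * b * c) ^ 2) ((a * b * c * a) * (a * b * c) * (a * b * c * a)) := by
  have h₁ := braid_conj_first hab hac
  have h₂ := braid_conj_second hbc hac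
  have h₃ := braid_conj_sq_third hab hbc hac
  generalize a * b * c = d at *
  have h₄ : d ^ 2 * a = c * d ^ 2 := by
    calc d ^ 2 * a = d * (d * a) := by simp only [pow_succ, pow_zero, one_mul, mul_assoc]
      _ = d * b * d := by rw [h₁]; simp only [mul_assoc]
      _ = c * d ^ 2 := by rw [h₂]; simp only [pow_succ, pow_zero, one_mul, mul_assoc]
  have h₅ : d * a * d * (d * a) = d * (a * c) * d ^ 2 := by
    calc d * a * d * (d * a) = d * a * (d ^ 2 * a) := by
          simp only [pow_succ, pow_zero, one_mul, mul_assoc]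
      _ = d * (a * c) * d ^ 2 := by rw [h₄]; simp only [mul_assoc]
  have h₆ : d ^ 2 * (a * c) = a * c * d ^ 2 := by
    calc d ^ 2 * (a * c) = d ^ 2 * a * c := by simp only [pow_succ, pow_zero, one_mul, mul_assoc]
      _ = c * (d ^ 2 * c) := by rw [h₄, mul_assoc]
      _ = a * c * d ^ 2 := by rw [h₃, ← mul_assoc, hac]
  rw [h₅]
  have h₇ : Commute (d ^ 2) (a * c) := h₆
  exact (((Commute.refl d).pow_left 2).mul_right h₇).mul_right (Commute.refl _)

end BraidRelations

namespace BraidGroup4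

theorem σB_rel₀₁ : σB 0 * σB 1 * σB 0 = σB 1 * σB 0 * σB 1 :=
  PresentedGroup.mk_eq_mk_of_mul_inv_mem (by simp [braidRels4])

theorem σB_rel₁₂ : σB 1 * σB 2 * σB 1 = σB 2 * σB 1 * σB 2 :=
  PresentedGroup.mk_eq_mk_of_mul_inv_mem (by simp [braidRels4])

theorem σB_rel₀₂ : σB 0 * σB 2 = σB 2 * σB 0 :=
  PresentedGroup.mk_eq_mk_of_mul_inv_mem (by simp [braidRels4])

theorem pow_four_mem_center :
    (σB 0 * σB 1 * σB 2) ^ 4 ∈ Subgroup.center BraidGroup4 := by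
  have h₀ := braid_first_pow_conj σB_rel₀₁ σB_rel₁₂ σB_rel₀₂
  have h₁ := braid_conj_first σB_rel₀₁ σB_rel₀₂
  have h₂ := braid_conj_second σB_rel₁₂ σB_rel₀₂
  have key : ∀ g, g ∈ Subgroup.centralizer {(σB 0 * σB 1 * σB 2) ^ 4} := by
    have hd : σB 0 * σB 1 * σB 2 ∈ Subgroup.centralizer {(σB 0 * σB 1 * σB 2) ^ 4} :=
      Subgroup.mem_centralizer_singleton_iff.2 (Commute.self_pow _ 4)
    have m₀ : σB 0 ∈ Subgroup.centralizer {(σB 0 * σB 1 * σB 2) ^ 4} :=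
      Subgroup.mem_centralizer_singleton_iff.2 h₀.symm
    have m₁ : σB 1 ∈ Subgroup.centralizer {(σB 0 * σB 1 * σB 2) ^ 4} := by
      refine (Subgroup.mul_mem_cancel_right _ hd).1 ?_
      rw [← h₁]
      exact mul_mem hd m₀
    have m₂ : σB 2 ∈ Subgroup.centralizer {(σB 0 * σB 1 * σB 2) ^ 4} := by
      refine (Subgroup.mul_mem_cancel_right _ hd).1 ?_
      rw [← h₂]
      exact mul_mem hd m₁
    refine PresentedGroup.generated_by _ _ fun i => ?_
    fin_cases i
    exacts [m₀, m₁, m₂]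
  exact Subgroup.mem_center_iff.2 fun g =>
    Subgroup.mem_centralizer_singleton_iff.1 (key g)

end BraidGroup4

section QuadRelations

variable {G : Type*} [Group G] {x y : G}

theorem quad_commute_outer (hx : x ^ 4 = 1) (hxy : Commute (x ^ 2) (y * x * y)) :
    x⁻¹ * y * (x * (x * (x⁻¹ * y) * x⁻¹) * x⁻¹) = x * (x * (x⁻¹ * y) * x⁻¹) * x⁻¹ * (x⁻¹ * y) := by
  have h := (hxy.inv_left).eq
  have h₁ : x⁻¹ ^ 3 = x := by rw [inv_pow, inv_eq_iff_mul_eq_one, ← pow_succ, hx]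
  calc _ = x⁻¹ * (y * x * y * (x ^ 2)⁻¹) := by group
    _ = x⁻¹ ^ 3 * (y * x * y) := by rw [← h]; group
    _ = x * y * x⁻¹ ^ 3 * y := by rw [h₁]; group
    _ = _ := by group

theorem quad_braid (hx : x ^ 4 = 1) (hy : y ^ 3 = 1) (hxy : Commute (x ^ 2) (y * x * y)) :
    x⁻¹ * y * (x * (x⁻¹ * y) * x⁻¹) * (x⁻¹ * y) =
      x * (x⁻¹ * y) * x⁻¹ * (x⁻¹ * y) * (x * (x⁻¹ * y) * x⁻¹) := by
  have h₁ : (x ^ 2)⁻¹ = x ^ 2 := by rw [inv_eq_iff_mul_eq_one, ← pow_add, hx]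
  have h₂ : y ^ 2 = y⁻¹ := by rw [eq_inv_iff_mul_eq_one, ← pow_succ, hy]
  calc _ = x⁻¹ * y ^ 2 * (x ^ 2)⁻¹ * y := by simp only [pow_two]; group
    _ = x⁻¹ * y⁻¹ * (x ^ 2 * (y * x * y)) * y⁻¹ * x⁻¹ := by rw [h₁, h₂]; group
    _ = y * x ^ 2 * y⁻¹ * x⁻¹ := by rw [hxy.eq]; group
    _ = y * (x ^ 2)⁻¹ * y ^ 2 * x⁻¹ := by rw [h₁, h₂]
    _ = _ := by simp only [pow_two]; group

theorem quad_prod (hx : x ^ 4 = 1) (hy : y ^ 3 = 1) :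
    x⁻¹ * y * (x * (x⁻¹ * y) * x⁻¹) * (x * (x * (x⁻¹ * y) * x⁻¹) * x⁻¹) = x := by
  calc _ = x⁻¹ * (y * y * y) * (x ^ 4)⁻¹ * x ^ 2 := by group
    _ = x := by rw [← pow_three', hx, hy]; group

end QuadRelations

namespace BraidGroup4

variable {G : Type*} [Group G]

/-- The homomorphism out of `B₄` determined by three elements satisfying the braid relations. -/
def lift (a b c : G) (hab : a * b * a = b * a * b) (hbc : b * c * b = c * b * c)
    (hac : a * c = c * a) : BraidGroup4 →* G :=
  PresentedGroup.toGroup (f := ![a, b, c]) <| by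
    simp [braidRels4, ← mul_assoc, hab, hbc, hac]

variable {a b c : G} (hab : a * b * a = b * a * b) (hbc : b * c * b = c * b * c)
  (hac : a * c = c * a)

@[simp]
theorem lift_σB_zero : lift a b c hab hbc hac (σB 0) = a := PresentedGroup.toGroup.of _

@[simp]
theorem lift_σB_one : lift a b c hab hbc hac (σB 1) = b := PresentedGroup.toGroup.of _

@[simp]
theorem lift_σB_two : lift a b c hab hbc hac (σB 2) = c := PresentedGroup.toGroup.of _

theorem hom_ext {f g : BraidGroup4 →* G} (h₀ : f (σB 0) = g (σB 0)) (h₁ : f (σB 1) = g (σB 1))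
    (h₂ : f (σB 2) = g (σB 2)) : f = g :=
  PresentedGroup.ext fun i => by fin_cases i <;> assumption

end BraidGroup4

/-- The group `⟨x, y | x⁴ = y³ = 1, [x², yxy] = 1⟩`. -/
abbrev QuadGroup : Type := PresentedGroup quadRels

namespace QuadGroup

variable {G : Type*} [Group G]

/-- The generator `x`. -/
def x : QuadGroup := PresentedGroup.of 0

/-- The generator `y`. -/
def y : QuadGroup := PresentedGroup.of 1

theorem x_pow : x ^ 4 = 1 :=
  PresentedGroup.one_of_mem (rels := quadRels) (x := FreeGroup.of 0 ^ 4) (by simp [quadRels])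

theorem y_pow : y ^ 3 = 1 :=
  PresentedGroup.one_of_mem (rels := quadRels) (x := FreeGroup.of 1 ^ 3) (by simp [quadRels])

theorem x_sq_commute : Commute (x ^ 2) (y * x * y) := by
  have h : (x ^ 2)⁻¹ * (y * x * y)⁻¹ * x ^ 2 * (y * x * y) = 1 :=
    PresentedGroup.one_of_mem (rels := quadRels) (x := (FreeGroup.of 0 ^ 2)⁻¹ *
      (FreeGroup.of 1 * FreeGroup.of 0 * FreeGroup.of 1)⁻¹ * FreeGroup.of 0 ^ 2 *
      (FreeGroup.of 1 * FreeGroup.of 0 * FreeGroup.of 1)) (by simp [quadRels])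
  rwa [mul_assoc, ← mul_inv_rev, inv_mul_eq_one, eq_comm] at h

/-- The homomorphism out of `QuadGroup` determined by two elements satisfying the relations. -/
def lift (a b : G) (ha : a ^ 4 = 1) (hb : b ^ 3 = 1) (hab : Commute (a ^ 2) (b * a * b)) :
    QuadGroup →* G :=
  PresentedGroup.toGroup (f := ![a, b]) <| by
    have h : (a ^ 2)⁻¹ * (b * a * b)⁻¹ * a ^ 2 * (b * a * b) = 1 := by
      rw [mul_assoc, ← mul_inv_rev, inv_mul_eq_one, hab.eq]
    rintro r (rfl | rfl | rfl)
    · simpa using ha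
    · simpa using hb
    · simpa only [map_mul, map_inv, map_pow, FreeGroup.lift_apply_of, Matrix.cons_val_zero,
        Matrix.cons_val_one] using h

section

variable {a b : G} (ha : a ^ 4 = 1) (hb : b ^ 3 = 1) (hab : Commute (a ^ 2) (b * a * b))

@[simp]
theorem lift_x : lift a b ha hb hab x = a := PresentedGroup.toGroup.of _

@[simp]
theorem lift_y : lift a b ha hb hab y = b := PresentedGroup.toGroup.of _

end

theorem hom_ext {f g : QuadGroup →* G} (hx : f x = g x) (hy : f y = g y) : f = g :=
  PresentedGroup.ext fun i => by fin_cases i <;> assumption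

theorem mem_of_generators_mem {H : Subgroup QuadGroup} (hx : x ∈ H) (hy : y ∈ H) (g : QuadGroup) :
    g ∈ H :=
  PresentedGroup.generated_by _ _ (fun i => by fin_cases i <;> assumption) g

/-- The free product of three groups of order two. -/
abbrev TripleProduct : Type := CyclicFreeProduct fun _ : Fin 3 => 2

/-- The three standard involutions generating `TripleProduct`. -/
abbrev involution (i : Fin 3) : TripleProduct := CyclicFreeProduct.gen _ i

theorem involution_sq (i : Fin 3) : involution i ^ 2 = 1 := CyclicFreeProduct.gen_pow i

@[simp]
theorem involution_mul_self (i : Fin 3) : involution i * involution i = 1 := by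
  rw [← pow_two, involution_sq]

@[simp]
theorem involution_mul_cancel (i : Fin 3) (w : TripleProduct) :
    involution i * (involution i * w) = w := by
  rw [← mul_assoc, involution_mul_self, one_mul]

@[simp]
theorem involution_inv (i : Fin 3) : (involution i)⁻¹ = involution i :=
  inv_eq_of_mul_eq_one_left (involution_mul_self i)

theorem tripleProduct_hom_ext {f g : TripleProduct →* G}
    (h₀ : f (involution 0) = g (involution 0)) (h₁ : f (involution 1) = g (involution 1))
    (h₂ : f (involution 2) = g (involution 2)) : f = g :=
  CyclicFreeProduct.hom_ext fun i => by fin_cases i <;> assumption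

theorem tripleProduct_mulAut_ext {f g : MulAut TripleProduct}
    (h₀ : f (involution 0) = g (involution 0)) (h₁ : f (involution 1) = g (involution 1))
    (h₂ : f (involution 2) = g (involution 2)) : f = g :=
  MulEquiv.toMonoidHom_injective (tripleProduct_hom_ext h₀ h₁ h₂)

/-- The homomorphism out of `TripleProduct` determined by three elements of order dividing two. -/
def tripleLift (a b c : G) (ha : a * a = 1) (hb : b * b = 1) (hc : c * c = 1) :
    TripleProduct →* G :=
  CyclicFreeProduct.lift ![a, b, c] fun i => by fin_cases i <;> simpa [pow_two]

section

variable {a b c : G} (ha : a * a = 1) (hb : b * b = 1) (hc : c * c = 1)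

@[simp]
theorem tripleLift_zero : tripleLift a b c ha hb hc (involution 0) = a :=
  CyclicFreeProduct.lift_gen ..

@[simp]
theorem tripleLift_one : tripleLift a b c ha hb hc (involution 1) = b :=
  CyclicFreeProduct.lift_gen ..

@[simp]
theorem tripleLift_two : tripleLift a b c ha hb hc (involution 2) = c :=
  CyclicFreeProduct.lift_gen ..

end

/-- The automorphism by which `x` acts on `TripleProduct`. -/
def autX : MulAut TripleProduct :=
  MonoidHom.toMulEquiv
    (tripleLift (involution 0) (involution 2) (involution 0 * involution 1 * involution 0)
      (by simp) (by simp) (by simp [mul_assoc]))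
    (tripleLift (involution 0) (involution 0 * involution 2 * involution 0) (involution 1)
      (by simp) (by simp [mul_assoc]) (by simp))
    (tripleProduct_hom_ext (by simp) (by simp) (by simp [mul_assoc]))
    (tripleProduct_hom_ext (by simp) (by simp [mul_assoc]) (by simp))

/-- The automorphism by which `y` acts on `TripleProduct`. -/
def autY : MulAut TripleProduct :=
  MonoidHom.toMulEquiv
    (tripleLift (involution 1) (involution 2) (involution 0) (by simp) (by simp) (by simp))
    (tripleLift (involution 2) (involution 0) (involution 1) (by simp) (by simp) (by simp))
    (tripleProduct_hom_ext (by simp) (by simp) (by simp))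
    (tripleProduct_hom_ext (by simp) (by simp) (by simp))

@[simp]
theorem autX_zero : autX (involution 0) = involution 0 := by
  simp [autX]

@[simp]
theorem autX_one : autX (involution 1) = involution 2 := by
  simp [autX]

@[simp]
theorem autX_two : autX (involution 2) = involution 0 * involution 1 * involution 0 := by
  simp [autX]

@[simp]
theorem autY_zero : autY (involution 0) = involution 1 := by
  simp [autY]

@[simp]
theorem autY_one : autY (involution 1) = involution 2 := by
  simp [autY]

@[simp]
theorem autY_two : autY (involution 2) = involution 0 := by
  simp [autY]

theorem autX_sq : autX ^ 2 = MulAut.conj (involution 0) :=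
  tripleProduct_mulAut_ext (by simp [pow_two]) (by simp [pow_two])
    (by simp [pow_two, mul_assoc])

theorem mul_conj_mul_inv {W : Type*} [Group W] (f : MulAut W) (w : W) :
    f * MulAut.conj w * f⁻¹ = MulAut.conj (f w) := by
  ext v
  simp

/-- The action of `QuadGroup` on `TripleProduct`. -/
def action : QuadGroup →* MulAut TripleProduct :=
  lift autX autY
    (by rw [show 4 = 2 * 2 from rfl, pow_mul, autX_sq, ← map_pow, involution_sq, map_one])
    (tripleProduct_mulAut_ext (by simp [pow_succ]) (by simp [pow_succ]) (by simp [pow_succ]))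
    (by
      rw [autX_sq]
      refine (mul_inv_eq_iff_eq_mul.1 ?_).symm
      rw [mul_conj_mul_inv]
      simp)

theorem conj_x_sq_mul_self (g : QuadGroup) :
    g * x ^ 2 * g⁻¹ * (g * x ^ 2 * g⁻¹) = 1 := by
  rw [← pow_two, conj_pow, ← pow_mul, x_pow, mul_one, mul_inv_cancel]

/-- The homomorphism from `TripleProduct` whose range is the normal closure of `x²`. -/
def inclusion : TripleProduct →* QuadGroup :=
  tripleLift (x ^ 2) (y * x ^ 2 * y⁻¹) (y ^ 2 * x ^ 2 * (y ^ 2)⁻¹)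
    (by simpa using conj_x_sq_mul_self 1) (conj_x_sq_mul_self y) (conj_x_sq_mul_self (y ^ 2))

@[simp]
theorem inclusion_zero : inclusion (involution 0) = x ^ 2 := by
  simp [inclusion]

@[simp]
theorem inclusion_one : inclusion (involution 1) = y * x ^ 2 * y⁻¹ := by
  simp [inclusion]

@[simp]
theorem inclusion_two : inclusion (involution 2) = y ^ 2 * x ^ 2 * (y ^ 2)⁻¹ := by
  simp [inclusion]

theorem action_inclusion (w : TripleProduct) : action (inclusion w) = MulAut.conj w := by
  have hx : action x = autX := lift_x ..
  have hy : action y = autY := lift_y ..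
  refine DFunLike.congr_fun (f := action.comp inclusion) (tripleProduct_hom_ext ?_ ?_ ?_) w
  · simp [hx, autX_sq]
  · simp [hx, hy, autX_sq, mul_conj_mul_inv]
  · simp only [MonoidHom.comp_apply, inclusion_two, map_mul, map_inv, map_pow, hx, hy, autX_sq,
      mul_conj_mul_inv]
    simp [pow_two]

theorem inclusion_injective : Function.Injective inclusion := by
  rw [injective_iff_map_eq_one]
  intro w hw
  have hconj : MulAut.conj w = 1 := by rw [← action_inclusion, hw, map_one]
  have hmem : w ∈ Subgroup.center TripleProduct := Subgroup.mem_center_iff.2 fun g =>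
    (mul_inv_eq_iff_eq_mul.1 (DFunLike.congr_fun hconj g)).symm
  rwa [CyclicFreeProduct.center_eq_bot (by simp), Subgroup.mem_bot] at hmem

theorem inclusion_action (g : QuadGroup) (w : TripleProduct) :
    inclusion (action g w) = g * inclusion w * g⁻¹ := by
  let H : Subgroup QuadGroup :=
    { carrier := {g | ∀ w, inclusion (action g w) = g * inclusion w * g⁻¹}
      one_mem' := by simp
      mul_mem' := fun {a b} ha hb w => by
        rw [map_mul, MulAut.mul_apply, ha, hb]; group
      inv_mem' := fun {a} ha w => by
        have := ha (action a⁻¹ w)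
        rw [← MulAut.mul_apply, ← map_mul, mul_inv_cancel, map_one, MulAut.one_apply] at this
        rw [this]; group }
  have key {a : QuadGroup}
      (h : inclusion.comp (action a).toMonoidHom = (MulAut.conj a).toMonoidHom.comp inclusion) :
      a ∈ H := fun w => DFunLike.congr_fun h w
  have hx : action x = autX := lift_x ..
  have hy : action y = autY := lift_y ..
  have hx2 : (x ^ 2)⁻¹ = x ^ 2 := by rw [inv_eq_iff_mul_eq_one, ← pow_add, x_pow]
  have hy2 : y⁻¹ = y ^ 2 := by rw [inv_eq_iff_mul_eq_one, ← pow_succ', y_pow]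
  refine mem_of_generators_mem (H := H) (key (tripleProduct_hom_ext ?_ ?_ ?_))
    (key (tripleProduct_hom_ext ?_ ?_ ?_)) g w
  · simp only [MonoidHom.comp_apply, MulEquiv.toMonoidHom_eq_coe, MonoidHom.coe_coe, hx, autX_zero,
      inclusion_zero, MulAut.conj_apply]
    group
  · simp only [MonoidHom.comp_apply, MulEquiv.toMonoidHom_eq_coe, MonoidHom.coe_coe, hx, autX_one,
      inclusion_one, inclusion_two, MulAut.conj_apply, ← hy2]
    calc y⁻¹ * x ^ 2 * y⁻¹⁻¹ = y⁻¹ * (x ^ 2 * (y * x * y)) * (y⁻¹ * x⁻¹) := by group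
      _ = x * (y * x ^ 2 * y⁻¹) * x⁻¹ := by rw [x_sq_commute.eq]; group
  · simp only [MonoidHom.comp_apply, MulEquiv.toMonoidHom_eq_coe, MonoidHom.coe_coe, hx, autX_two,
      map_mul inclusion, inclusion_zero, inclusion_one, inclusion_two, MulAut.conj_apply, ← hy2]
    calc x ^ 2 * (y * x ^ 2 * y⁻¹) * x ^ 2
        = x ^ 2 * (y * x ^ 2 * y⁻¹) * (x ^ 2)⁻¹ := by rw [hx2]
      _ = x * (y⁻¹ * (y * x * y * x ^ 2) * y⁻¹ * x⁻¹) * x⁻¹ := by simp only [pow_two]; group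
      _ = x * (y⁻¹ * x ^ 2 * y⁻¹⁻¹) * x⁻¹ := by rw [← x_sq_commute.eq]; group
  · simp [hy]
  · simp only [MonoidHom.comp_apply, MulEquiv.toMonoidHom_eq_coe, MonoidHom.coe_coe, hy, autY_one,
      inclusion_one, inclusion_two, MulAut.conj_apply, pow_two y]
    group
  · simp only [MonoidHom.comp_apply, MulEquiv.toMonoidHom_eq_coe, MonoidHom.coe_coe, hy, autY_two,
      inclusion_zero, inclusion_two, MulAut.conj_apply]
    calc x ^ 2 = y ^ 3 * x ^ 2 * (y ^ 3)⁻¹ := by rw [y_pow]; group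
      _ = y * (y ^ 2 * x ^ 2 * (y ^ 2)⁻¹) * y⁻¹ := by group

instance : inclusion.range.Normal where
  conj_mem := by
    rintro _ ⟨w, rfl⟩ g
    exact ⟨action g w, inclusion_action g w⟩

theorem center_le_range_inclusion : Subgroup.center QuadGroup ≤ inclusion.range := by
  let P := CyclicFreeProduct (![2, 3] : Fin 2 → ℕ)
  let gen (i : Fin 2) : P := CyclicFreeProduct.gen _ i
  have hg₀ : gen 0 ^ 2 = 1 := CyclicFreeProduct.gen_pow (n := ![2, 3]) 0
  have hg₀' : gen 0 ^ 4 = 1 := by rw [show 4 = 2 * 2 from rfl, pow_mul, hg₀, one_pow]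
  let toP : QuadGroup →* P := lift (gen 0) (gen 1) hg₀'
    (CyclicFreeProduct.gen_pow (n := ![2, 3]) 1) (by rw [hg₀]; exact Commute.one_left _)
  have h_toP_x : toP x = gen 0 := lift_x ..
  have h_toP_y : toP y = gen 1 := lift_y ..
  have hx2 : (x : QuadGroup ⧸ inclusion.range) ^ 2 = 1 :=
    (QuotientGroup.eq_one_iff (x ^ 2)).2 ⟨involution 0, inclusion_zero⟩
  have hy3 : (y : QuadGroup ⧸ inclusion.range) ^ 3 = 1 :=
    congrArg (QuotientGroup.mk' inclusion.range) y_pow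
  let fromP : P →* QuadGroup ⧸ inclusion.range :=
    CyclicFreeProduct.lift ![(x : QuadGroup ⧸ inclusion.range), y] fun i => by
      fin_cases i <;> assumption
  have h_comp : fromP.comp toP = QuotientGroup.mk' inclusion.range := by
    refine hom_ext ?_ ?_
    · rw [MonoidHom.comp_apply, h_toP_x]
      exact CyclicFreeProduct.lift_gen ..
    · rw [MonoidHom.comp_apply, h_toP_y]
      exact CyclicFreeProduct.lift_gen ..
  have h_surj : toP.range = ⊤ := by
    have h_id : (toP.range.subtype).comp (CyclicFreeProduct.lift (n := ![2, 3])
        ![⟨gen 0, x, h_toP_x⟩, ⟨gen 1, y, h_toP_y⟩] fun i => Subtype.ext <| by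
          fin_cases i
          exacts [CyclicFreeProduct.gen_pow (n := ![2, 3]) 0,
            CyclicFreeProduct.gen_pow (n := ![2, 3]) 1]) = MonoidHom.id P := by
      refine CyclicFreeProduct.hom_ext fun i => ?_
      rw [MonoidHom.comp_apply, CyclicFreeProduct.lift_gen]
      fin_cases i <;> rfl
    rw [eq_top_iff]
    intro p _
    have := DFunLike.congr_fun h_id p
    rw [MonoidHom.id_apply] at this
    rw [← this]
    exact Subtype.property _
  intro c hc
  have hmem : toP c ∈ Subgroup.center P := by
    refine Subgroup.mem_center_iff.2 fun p => ?_
    obtain ⟨g, rfl⟩ := MonoidHom.range_eq_top.1 h_surj p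
    rw [← map_mul, ← map_mul, Subgroup.mem_center_iff.1 hc g]
  rw [CyclicFreeProduct.center_eq_bot (fun i => by fin_cases i <;> simp), Subgroup.mem_bot] at hmem
  refine (QuotientGroup.eq_one_iff c).1 ?_
  rw [← QuotientGroup.mk'_apply, ← h_comp, MonoidHom.comp_apply, hmem, map_one]

theorem center_eq_bot : Subgroup.center QuadGroup = ⊥ := by
  rw [eq_bot_iff]
  intro c hc
  obtain ⟨w, rfl⟩ := center_le_range_inclusion hc
  have hw : w ∈ Subgroup.center TripleProduct := by
    refine Subgroup.mem_center_iff.2 fun v => inclusion_injective ?_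
    rw [map_mul, map_mul, Subgroup.mem_center_iff.1 hc]
  rw [CyclicFreeProduct.center_eq_bot (by simp), Subgroup.mem_bot] at hw
  rw [hw, map_one]
  exact one_mem _

end QuadGroup

namespace BraidGroup4

/-- The homomorphism from `B₄` to `QuadGroup` with `σ₁σ₂σ₃ ↦ x` and `σ₁σ₂σ₃σ₁ ↦ y`. -/
def toQuad : BraidGroup4 →* QuadGroup :=
  have h := quad_braid QuadGroup.x_pow QuadGroup.y_pow QuadGroup.x_sq_commute
  lift (QuadGroup.x⁻¹ * QuadGroup.y) (QuadGroup.x * (QuadGroup.x⁻¹ * QuadGroup.y) * QuadGroup.x⁻¹)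
    (QuadGroup.x * (QuadGroup.x * (QuadGroup.x⁻¹ * QuadGroup.y) * QuadGroup.x⁻¹) * QuadGroup.x⁻¹)
    h
    (by simpa only [conj_mul] using congrArg (fun g => QuadGroup.x * g * QuadGroup.x⁻¹) h)
    (quad_commute_outer QuadGroup.x_pow QuadGroup.x_sq_commute)

theorem toQuad_prod : toQuad (σB 0 * σB 1 * σB 2) = QuadGroup.x := by
  simp only [toQuad, map_mul, lift_σB_zero, lift_σB_one, lift_σB_two]
  exact quad_prod QuadGroup.x_pow QuadGroup.y_pow

theorem toQuad_prod_mul : toQuad (σB 0 * σB 1 * σB 2 * σB 0) = QuadGroup.y := by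
  rw [map_mul, toQuad_prod, toQuad, lift_σB_zero, mul_inv_cancel_left]

theorem toQuad_surjective : Function.Surjective toQuad :=
  QuadGroup.mem_of_generators_mem (H := toQuad.range) ⟨_, toQuad_prod⟩ ⟨_, toQuad_prod_mul⟩

/-- The homomorphism from `QuadGroup` to `B₄` modulo its center with `x ↦ σ₁σ₂σ₃` and
`y ↦ σ₁σ₂σ₃σ₁`. -/
def ofQuad : QuadGroup →* BraidGroup4 ⧸ Subgroup.center BraidGroup4 :=
  QuadGroup.lift (QuotientGroup.mk' _ (σB 0 * σB 1 * σB 2))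
    (QuotientGroup.mk' _ (σB 0 * σB 1 * σB 2 * σB 0))
    (by
      rw [← map_pow]
      exact (QuotientGroup.eq_one_iff _).2 pow_four_mem_center)
    (by
      rw [← map_pow, braid_cube_eq σB_rel₀₁ σB_rel₁₂ σB_rel₀₂]
      exact (QuotientGroup.eq_one_iff _).2 pow_four_mem_center)
    (by
      rw [← map_pow, ← map_mul, ← map_mul]
      exact (braid_sq_commute σB_rel₀₁ σB_rel₁₂ σB_rel₀₂).map _)

theorem ofQuad_comp_toQuad :
    ofQuad.comp toQuad = QuotientGroup.mk' (Subgroup.center BraidGroup4) := by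
  have hx : ofQuad QuadGroup.x = QuotientGroup.mk' _ (σB 0 * σB 1 * σB 2) := QuadGroup.lift_x ..
  have hy : ofQuad QuadGroup.y = QuotientGroup.mk' _ (σB 0 * σB 1 * σB 2 * σB 0) :=
    QuadGroup.lift_y ..
  have h₀ : ofQuad (QuadGroup.x⁻¹ * QuadGroup.y) = QuotientGroup.mk' _ (σB 0) := by
    rw [map_mul, map_inv, hx, hy, ← map_inv, ← map_mul, inv_mul_cancel_left]
  refine hom_ext ?_ ?_ ?_
  · rw [MonoidHom.comp_apply, toQuad, lift_σB_zero, h₀]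
  · rw [MonoidHom.comp_apply, toQuad, lift_σB_one, map_mul, map_mul, map_inv, h₀, hx, ← map_mul,
      ← map_inv, ← map_mul, braid_conj_first σB_rel₀₁ σB_rel₀₂, mul_inv_cancel_right]
  · rw [MonoidHom.comp_apply, toQuad, lift_σB_two]
    simp only [map_mul ofQuad QuadGroup.x, map_mul ofQuad _ QuadGroup.x⁻¹, map_inv, h₀, hx]
    rw [← map_mul, ← map_inv, ← map_mul, braid_conj_first σB_rel₀₁ σB_rel₀₂, mul_inv_cancel_right,
      ← map_mul, ← map_mul, braid_conj_second σB_rel₁₂ σB_rel₀₂, mul_inv_cancel_right]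

theorem ker_toQuad : toQuad.ker = Subgroup.center BraidGroup4 := by
  refine le_antisymm (fun g hg => ?_) fun g hg => ?_
  · refine (QuotientGroup.eq_one_iff g).1 ?_
    rw [← QuotientGroup.mk'_apply, ← ofQuad_comp_toQuad, MonoidHom.comp_apply, hg, map_one]
  · rw [MonoidHom.mem_ker, ← Subgroup.mem_bot, ← QuadGroup.center_eq_bot]
    refine Subgroup.mem_center_iff.2 fun q => ?_
    obtain ⟨b, rfl⟩ := toQuad_surjective q
    rw [← map_mul, ← map_mul, Subgroup.mem_center_iff.1 hg b]

end BraidGroup4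

/-- `B₄/Z(B₄)` has the presentation
`⟨x, y | x⁴ = y³ = 1, [x², yxy] = 1⟩`, with `x = σ₁σ₂σ₃` and `y = σ₁σ₂σ₃σ₁`. -/
theorem b4_mod_center_presentation :
    ∃ e : (BraidGroup4 ⧸ Subgroup.center BraidGroup4) ≃* PresentedGroup quadRels,
      e (QuotientGroup.mk (σB 0 * σB 1 * σB 2)) = PresentedGroup.of 0 ∧
      e (QuotientGroup.mk (σB 0 * σB 1 * σB 2 * σB 0)) = PresentedGroup.of 1 := by
  refine ⟨(QuotientGroup.quotientMulEquivOfEq BraidGroup4.ker_toQuad.symm).trans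
    (QuotientGroup.quotientKerEquivOfSurjective _ BraidGroup4.toQuad_surjective), ?_, ?_⟩
  · exact BraidGroup4.toQuad_prod
  · exact BraidGroup4.toQuad_prod_mul
end

section
/- The element w = u⁻¹x⁻¹y⁻¹xyxy has infinite order in PGL(3, ℤ_3(t)), i.e., no positive power of w is a scalar matrix. -/
set_option synthInstance.maxHeartbeats 1000000

/-- The reduced Burau matrices of `σ₁, σ₂, σ₃` over `ℤ_3(t)`. -/
noncomputable def burauGen3 (i : Fin 3) : Matrix (Fin 3) (Fin 3) (RatFunc (ZMod 3)) :=
  let t : RatFunc (ZMod 3) := RatFunc.X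
  match i with
  | 0 => !![-t, 0, 0; 1, 1, 0; 0, 0, 1]
  | 1 => !![1, t, 0; 0, -t, 0; 0, 1, 1]
  | 2 => !![1, 0, 0; 0, 1, t; 0, 0, -t]

/-- `x = β₄(σ₁σ₂σ₃)` over `ℤ_3`. -/
noncomputable def xBurau3 : Matrix (Fin 3) (Fin 3) (RatFunc (ZMod 3)) :=
  burauGen3 0 * burauGen3 1 * burauGen3 2

/-- `y = β₄(σ₁σ₂σ₃σ₁)` over `ℤ_3`. -/
noncomputable def yBurau3 : Matrix (Fin 3) (Fin 3) (RatFunc (ZMod 3)) :=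
  xBurau3 * burauGen3 0

/-- The order-6 matrix `u` over `ℤ_3(t)`. -/
noncomputable def uMat3 : Matrix (Fin 3) (Fin 3) (RatFunc (ZMod 3)) :=
  let t : RatFunc (ZMod 3) := RatFunc.X
  !![2 + t + t ^ 2, 2 + t ^ 2, 2 + 2 * t + 2 * t ^ 2;
     2 + 2 * t ^ 2, 2 + t + 2 * t ^ 2, 2 + t + t ^ 2;
     2 + t, 2 + t, 2 + 2 * t]

/-- `w = u⁻¹x⁻¹y⁻¹xyxy`. -/
noncomputable def wMat3 : Matrix (Fin 3) (Fin 3) (RatFunc (ZMod 3)) :=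
  uMat3⁻¹ * xBurau3⁻¹ * yBurau3⁻¹ * xBurau3 * yBurau3 * xBurau3 * yBurau3

section TopCoefficients

open Polynomial

variable {R m : Type*} [CommRing R] [Fintype m]

lemma Matrix.natDegree_mul_apply_le {A B : Matrix m m R[X]} {a b : ℕ}
    (hA : ∀ i j, (A i j).natDegree ≤ a) (hB : ∀ i j, (B i j).natDegree ≤ b) (i j : m) :
    ((A * B) i j).natDegree ≤ a + b := by
  rw [Matrix.mul_apply]
  exact natDegree_sum_le_of_forall_le _ _ fun k _ => natDegree_mul_le_of_le (hA i k) (hB k j)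

lemma Matrix.map_coeff_mul_of_natDegree_le {A B : Matrix m m R[X]} {a b : ℕ}
    (hA : ∀ i j, (A i j).natDegree ≤ a) (hB : ∀ i j, (B i j).natDegree ≤ b) :
    (A * B).map (coeff · (a + b)) = A.map (coeff · a) * B.map (coeff · b) := by
  ext i j
  simp only [Matrix.map_apply, Matrix.mul_apply, finsetSum_coeff]
  exact Finset.sum_congr rfl fun k _ => coeff_mul_add_eq_of_natDegree_le (hA i k) (hB k j)

/-- If all entries of `A` have degree at most `d`, the matrix of coefficients of degree `n * d`
of `A ^ n` is the `n`-th power of the matrix of coefficients of degree `d` of `A`. -/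
lemma Matrix.map_coeff_pow_of_natDegree_le [DecidableEq m] {A : Matrix m m R[X]} {d : ℕ}
    (hA : ∀ i j, (A i j).natDegree ≤ d) (n : ℕ) :
    (A ^ n).map (coeff · (n * d)) = A.map (coeff · d) ^ n := by
  suffices h : (∀ i j, ((A ^ n) i j).natDegree ≤ n * d) ∧
      (A ^ n).map (coeff · (n * d)) = A.map (coeff · d) ^ n from h.2
  induction n with
  | zero =>
    refine ⟨fun i j => ?_, ?_⟩
    · by_cases h : i = j <;> simp [h]
    · ext i j
      by_cases h : i = j <;> simp [h]
  | succ n ih =>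
    rw [pow_succ, pow_succ, Nat.succ_mul]
    exact ⟨Matrix.natDegree_mul_apply_le ih.1 hA,
      by rw [Matrix.map_coeff_mul_of_natDegree_le ih.1 hA, ih.2]⟩

end TopCoefficients

section

open Polynomial

/-- The polynomial matrix `t² w`. -/
noncomputable def wPoly : Matrix (Fin 3) (Fin 3) (ZMod 3)[X] :=
  !![1 + 2 * X + 2 * X ^ 2 + 2 * X ^ 3, 1 + X ^ 2 + 2 * X ^ 3, X + X ^ 3 + X ^ 5;
     X ^ 2 + 2 * X ^ 3 + X ^ 4, X ^ 2 + X ^ 3 + X ^ 4, X ^ 3 + X ^ 4 + 2 * X ^ 6;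
     2 + X ^ 2 + 2 * X ^ 3 + X ^ 4, 2 + 2 * X + X ^ 2 + X ^ 3 + X ^ 4,
       2 * X + 2 * X ^ 2 + X ^ 3 + 2 * X ^ 6]

lemma natDegree_wPoly_le (i j : Fin 3) : (wPoly i j).natDegree ≤ 6 := by
  fin_cases i <;> fin_cases j <;> simp [wPoly] <;> compute_degree!

lemma map_coeff_wPoly :
    wPoly.map (coeff · 6) = !![0, 0, 0; 0, 0, 2; 0, 0, 2] := by
  have h2 (p : (ZMod 3)[X]) (n : ℕ) : (2 * p).coeff n = 2 * p.coeff n := by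
    rw [← C_ofNat, coeff_C_mul]
  ext i j
  fin_cases i <;> fin_cases j <;>
    simp [wPoly, coeff_X, coeff_one, h2, coeff_X_pow, coeff_ofNat_succ]

lemma wPoly_pow_apply_ne_zero {n : ℕ} (hn : 0 < n) : (wPoly ^ n) 1 2 ≠ 0 := by
  obtain ⟨k, rfl⟩ := Nat.exists_eq_succ_of_ne_zero hn.ne'
  have hpow : (!![0, 0, 0; 0, 0, 2; 0, 0, 2] : Matrix (Fin 3) (Fin 3) (ZMod 3)) ^ (k + 1) =
      (2 : ZMod 3) ^ k • !![0, 0, 0; 0, 0, 2; 0, 0, 2] := by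
    induction k with
    | zero => simp
    | succ k ih =>
      rw [pow_succ, ih (Nat.succ_pos k), pow_succ, mul_smul, smul_mul_assoc]
      congr 1
      decide
  have h := Matrix.map_coeff_pow_of_natDegree_le natDegree_wPoly_le (k + 1)
  rw [map_coeff_wPoly, hpow] at h
  intro h0
  have h12 := congrFun (congrFun h 1) 2
  rw [Matrix.map_apply, h0] at h12
  have h2 : (2 : ZMod 3) ≠ 0 := by decide
  simp [h2] at h12

lemma X_sq_smul_wMat3 :
    (RatFunc.X : RatFunc (ZMod 3)) ^ 2 • wMat3 =
      wPoly.map (algebraMap (ZMod 3)[X] (RatFunc (ZMod 3))) := by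
  have hX : (RatFunc.X : RatFunc (ZMod 3)) ≠ 0 := RatFunc.X_ne_zero
  have h2 : algebraMap (ZMod 3)[X] (RatFunc (ZMod 3)) 2 = 2 := map_ofNat _ 2
  have hw : wPoly.map (algebraMap (ZMod 3)[X] (RatFunc (ZMod 3))) =
      (let t : RatFunc (ZMod 3) := RatFunc.X
      !![1 + 2 * t + 2 * t ^ 2 + 2 * t ^ 3, 1 + t ^ 2 + 2 * t ^ 3, t + t ^ 3 + t ^ 5;
       t ^ 2 + 2 * t ^ 3 + t ^ 4, t ^ 2 + t ^ 3 + t ^ 4, t ^ 3 + t ^ 4 + 2 * t ^ 6;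
       2 + t ^ 2 + 2 * t ^ 3 + t ^ 4, 2 + 2 * t + t ^ 2 + t ^ 3 + t ^ 4,
         2 * t + 2 * t ^ 2 + t ^ 3 + 2 * t ^ 6]) := by
    ext i j
    fin_cases i <;> fin_cases j <;> simp [wPoly, RatFunc.algebraMap_X, h2]
  have hx : xBurau3 = (let t : RatFunc (ZMod 3) := RatFunc.X
      !![-t, -t ^ 2, -t ^ 3; 1, 0, 0; 0, 1, 0]) := by
    ext i j
    fin_cases i <;> fin_cases j <;>
      simp [xBurau3, burauGen3, Matrix.mul_apply, Fin.sum_univ_three] <;> ring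
  have hy : yBurau3 = (let t : RatFunc (ZMod 3) := RatFunc.X
      !![0, -t ^ 2, -t ^ 3; -t, 0, 0; 1, 1, 0]) := by
    ext i j
    fin_cases i <;> fin_cases j <;>
      simp [yBurau3, hx, burauGen3, Matrix.mul_apply, Fin.sum_univ_three] <;> ring
  have hdet : IsUnit (yBurau3 * xBurau3 * uMat3).det := by
    have : (yBurau3 * xBurau3 * uMat3).det = RatFunc.X ^ 10 := by
      rw [Matrix.det_mul, Matrix.det_mul, hx, hy]
      simp only [uMat3, Matrix.det_fin_three, Matrix.of_apply, Matrix.cons_val]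
      grind
    rw [this]
    exact (pow_ne_zero _ hX).isUnit
  have hmul : yBurau3 * xBurau3 * uMat3 * wPoly.map (algebraMap (ZMod 3)[X] (RatFunc (ZMod 3))) =
      (RatFunc.X : RatFunc (ZMod 3)) ^ 2 • (xBurau3 * yBurau3 * (xBurau3 * yBurau3)) := by
    rw [hw, hx, hy]
    ext i j
    fin_cases i <;> fin_cases j <;>
      simp [uMat3, Matrix.mul_apply, Fin.sum_univ_three] <;> grind
  have hwMat : wMat3 =
      (yBurau3 * xBurau3 * uMat3)⁻¹ * (xBurau3 * yBurau3 * (xBurau3 * yBurau3)) := by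
    simp only [wMat3, Matrix.mul_inv_rev, Matrix.mul_assoc]
  rw [hwMat, ← Matrix.mul_smul, ← hmul, Matrix.nonsing_inv_mul_cancel_left _ _ hdet]

end

/-- `w = u⁻¹x⁻¹y⁻¹xyxy` has infinite order in `PGL(3, ℤ_3(t))`:
no positive power of `w` is a scalar matrix. -/
theorem w_infinite_order_mod_scalars :
    ∀ n : ℕ, 0 < n → ∀ c : RatFunc (ZMod 3),
      wMat3 ^ n ≠ c • (1 : Matrix (Fin 3) (Fin 3) (RatFunc (ZMod 3))) := by
  intro n hn c h
  refine wPoly_pow_apply_ne_zero hn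
    ((map_eq_zero_iff _ (IsFractionRing.injective _ (RatFunc (ZMod 3)))).mp ?_)
  have hpow := congrArg (· ^ n) X_sq_smul_wMat3
  simp only [smul_pow, h, ← RingHom.mapMatrix_apply, ← map_pow] at hpow
  simpa using (congrFun (congrFun hpow 1) 2).symm
end
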